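/- Let K(x) := 1/(2π²|x|²) on ℝ³. Then K is a fundamental solution of (−Δ)^{1/2} in ℝ³ in the following sense: for every f ∈ L¹(ℝ³), the convolution (K∗f)(x) = ∫_{ℝ³} K(x−y) f(y) dy is defined for almost every x, K∗f ∈ L_{1/2}(ℝ³), and ∫_{ℝ³} (K∗f)(x)·((−Δ)^{1/2}φ)(x) dx = ∫_{ℝ³} f(x) φ(x) dx for every Schwartz function φ : ℝ³ → ℝ. -/

import Mathlib

open MeasureTheory Real Filter

noncomputable section

abbrev E3 := EuclideanSpace ℝ (Fin 3)

/-- The Laplacian of `f : ℝ³ → ℝ` as the sum of second partial derivatives. -/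
def lap (f : E3 → ℝ) (x : E3) : ℝ :=
  ∑ i, fderiv ℝ (fun y => fderiv ℝ f y (EuclideanSpace.single i 1)) x (EuclideanSpace.single i 1)

/-- The half Laplacian `(-Δ)^{1/2} φ` of a Schwartz function on ℝ³, defined as a
principal value: `(1/π²) lim_{ε→0⁺} ∫_{|x−y|>ε} (φ(x)−φ(y))/|x−y|⁴ dy`. -/
def halfLap (φ : SchwartzMap E3 ℝ) (x : E3) : ℝ :=
  limUnder (nhdsWithin (0:ℝ) (Set.Ioi 0)) fun ε =>
    (1 / π ^ 2) * ∫ y in {y : E3 | ε < ‖x - y‖}, (φ x - φ y) / ‖x - y‖ ^ 4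

/-- `w ∈ L_{1/2}(ℝ³)`. -/
def MemL12 (w : E3 → ℝ) : Prop :=
  LocallyIntegrable w volume ∧ Integrable (fun x => |w x| / (1 + ‖x‖ ^ 4)) volume

/-- `u` is a smooth solution of `(-Δ)^{3/2} u = 2 e^{3u}` in ℝ³ with finite volume. -/
def IsSolution (u : E3 → ℝ) : Prop :=
  ContDiff ℝ (⊤ : ℕ∞) u ∧ MemL12 (lap u) ∧ Integrable (fun x => exp (3 * u x)) volume ∧
    ∀ φ : SchwartzMap E3 ℝ,
      ∫ x, (-(lap u x)) * halfLap φ x = 2 * ∫ x, exp (3 * u x) * φ x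

/-- `u` is a spherical solution. -/
def IsSpherical (u : E3 → ℝ) : Prop :=
  ∃ lam : ℝ, 0 < lam ∧ ∃ x₀ : E3, ∀ x, u x = log (2 * lam / (1 + lam ^ 2 * ‖x - x₀‖ ^ 2))

/-- `α = (1/π²) ∫ e^{3u}`. -/
def solAlpha (u : E3 → ℝ) : ℝ := (1 / π ^ 2) * ∫ y, exp (3 * u y)

/-- `v(x) = (1/π²) ∫ log(|y|/|x−y|) e^{3u(y)} dy`. -/
def solV (u : E3 → ℝ) (x : E3) : ℝ :=
  (1 / π ^ 2) * ∫ y, log (‖y‖ / ‖x - y‖) * exp (3 * u y)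

end

lemma integrable_indicator_ball_inv_norm_sq :
    Integrable (fun x : E3 => (Set.Iio (1:ℝ)).indicator (fun r => 1 / r ^ 2) ‖x‖) := by
  rw [integrable_fun_norm_addHaar]
  have h : IntegrableOn (fun _ : ℝ => (1:ℝ)) (Set.Ioo 0 1) := by simp
  have h2 : IntegrableOn ((Set.Ioo (0:ℝ) 1).indicator (fun _ : ℝ => (1:ℝ))) (Set.Ioi 0) :=
    (h.integrable_indicator measurableSet_Ioo).integrableOn
  refine h2.congr_fun (fun r hr => ?_) measurableSet_Ioi
  have hr' : 0 < r := hr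
  by_cases h1 : r < 1
  · have : r ∈ Set.Ioo (0:ℝ) 1 := ⟨hr', h1⟩
    rw [Set.indicator_of_mem this]
    simp [h1, finrank_euclideanSpace]
    field_simp
  · simp [h1]

lemma integrable_indicator_inv_norm_pow_four {ε : ℝ} (hε : 0 < ε) :
    Integrable (fun x : E3 => (Set.Ioi ε).indicator (fun r => 1 / r ^ 4) ‖x‖) := by
  have h := (integrable_one_add_norm (E := E3) (μ := volume) (r := 4)
    (by simp [finrank_euclideanSpace]; norm_num)).const_mul ((1 + 1 / ε) ^ 4)
  refine h.mono' ?_ (ae_of_all _ fun x => ?_)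
  · refine Measurable.aestronglyMeasurable ?_
    exact ((by fun_prop : Measurable fun r : ℝ => 1 / r ^ 4).indicator measurableSet_Ioi).comp
      measurable_norm
  · by_cases hx : ε < ‖x‖
    · rw [Set.indicator_of_mem (by exact hx), norm_of_nonneg (by positivity),
        rpow_neg (by positivity), show (4:ℝ) = ((4:ℕ):ℝ) by norm_num, rpow_natCast,
        ← one_div, mul_one_div, div_le_div_iff₀ (by have := hε.trans hx; positivity)
        (by positivity), one_mul, ← mul_pow]
      gcongr
      have : 1 ≤ ‖x‖ / ε := by rw [one_le_div hε]; exact hx.le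
      calc 1 + ‖x‖ ≤ ‖x‖ / ε + ‖x‖ := by gcongr
        _ = _ := by ring
    · rw [Set.indicator_of_notMem (by exact hx)]
      simp; positivity

/-- The Riesz kernel `|x - y|⁻²` against an integrable and a bounded integrable function. -/
lemma integrable_inv_norm_sub_sq_mul {f w : E3 → ℝ} (hf : Integrable f) (hw : Integrable w)
    {M : ℝ} (hM : ∀ᵐ x, ‖w x‖ ≤ M) :
    Integrable (fun p : E3 × E3 => 1 / ‖p.1 - p.2‖ ^ 2 * f p.2 * w p.1) (volume.prod volume) := by
  have h1 := Integrable.convolution_integrand (ContinuousLinearMap.mul ℝ ℝ) hf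
    integrable_indicator_ball_inv_norm_sq
  have hwm : AEStronglyMeasurable (fun p : E3 × E3 => w p.1) (volume.prod volume) :=
    hw.1.comp_fst
  have h2 := h1.bdd_mul (f := fun p : E3 × E3 => w p.1) hwm
    (Measure.quasiMeasurePreserving_fst.ae hM)
  have h3 := hw.mul_prod hf
  have h4 := h3.bdd_mul (c := 1)
    (f := fun p : E3 × E3 => (Set.Ici (1:ℝ)).indicator (fun r => 1 / r ^ 2) ‖p.1 - p.2‖)
    (by
      refine Measurable.aestronglyMeasurable ?_
      exact ((by fun_prop : Measurable fun r : ℝ => 1 / r ^ 2).indicator measurableSet_Ici).comp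
        (by fun_prop))
    (ae_of_all _ fun p => by
      by_cases hx : 1 ≤ ‖p.1 - p.2‖
      · rw [Set.indicator_of_mem (by exact hx), norm_of_nonneg (by positivity)]
        rw [div_le_one (by positivity)]
        nlinarith
      · rw [Set.indicator_of_notMem (by exact hx)]
        simp)
  refine (h2.add h4).congr (ae_of_all _ fun p => ?_)
  by_cases hx : 1 ≤ ‖p.1 - p.2‖
  · simp [Set.indicator, hx, not_lt.2 hx]; ring
  · simp [Set.indicator, hx, not_le.1 hx]; ring

lemma integrable_one_div_one_add_norm_pow_four :
    Integrable (fun x : E3 => 1 / (1 + ‖x‖ ^ 4)) := by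
  have h := (integrable_one_add_norm (E := E3) (μ := volume) (r := 4)
    (by simp [finrank_euclideanSpace]; norm_num)).const_mul 8
  refine h.mono' (by measurability) (ae_of_all _ fun x => ?_)
  rw [norm_of_nonneg (by positivity), rpow_neg (by positivity),
    show (4:ℝ) = ((4:ℕ):ℝ) by norm_num, rpow_natCast, ← one_div, mul_one_div,
    div_le_div_iff₀ (by positivity) (by positivity), one_mul]
  nlinarith [sq_nonneg (‖x‖ - 1), sq_nonneg (‖x‖ ^ 2 - 1), sq_nonneg (‖x‖ ^ 2 - ‖x‖),
    norm_nonneg x, sq_nonneg (‖x‖ ^ 2 - 2 * ‖x‖ + 1)]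

/-- The convolution `K ∗ f` with the Riesz kernel `K(x) = 1 / (2π²|x|²)`. -/
noncomputable def rieszConv (f : E3 → ℝ) (x : E3) : ℝ :=
  ∫ y, 1 / (2 * Real.pi ^ 2 * ‖x - y‖ ^ 2) * f y

lemma riesz_kernel_eq (x y : E3) (a : ℝ) :
    1 / (2 * Real.pi ^ 2 * ‖x - y‖ ^ 2) * a = 1 / (2 * π ^ 2) * (1 / ‖x - y‖ ^ 2 * a) := by
  rw [← one_div_mul_one_div]; ring

lemma ae_integrable_riesz {f : E3 → ℝ} (hf : Integrable f) :
    ∀ᵐ x : E3, Integrable (fun y : E3 => 1 / (2 * Real.pi ^ 2 * ‖x - y‖ ^ 2) * f y) := by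
  have h := (integrable_inv_norm_sub_sq_mul hf integrable_one_div_one_add_norm_pow_four (M := 1)
    (ae_of_all _ fun x => by
      rw [norm_of_nonneg (by positivity)]
      exact div_le_one_of_le₀ (by nlinarith [sq_nonneg (‖x‖^2)]) (by positivity))).prod_right_ae
  filter_upwards [h] with x hx
  refine (hx.const_mul (1 / (2 * π ^ 2) * (1 + ‖x‖ ^ 4))).congr (ae_of_all _ fun y => ?_)
  have : 1 + ‖x‖ ^ 4 ≠ 0 := by positivity
  simp only [riesz_kernel_eq]
  field_simp

lemma memL12_rieszConv {f : E3 → ℝ} (hf : Integrable f) : MemL12 (rieszConv f) := by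
  have h := (integrable_inv_norm_sub_sq_mul hf integrable_one_div_one_add_norm_pow_four (M := 1)
    (ae_of_all _ fun x => by
      rw [norm_of_nonneg (by positivity)]
      exact div_le_one_of_le₀ (by nlinarith [sq_nonneg (‖x‖^2)]) (by positivity))).integral_prod_left
  have h' : Integrable (fun x => rieszConv f x / (1 + ‖x‖ ^ 4)) := by
    refine (h.const_mul (1 / (2 * π ^ 2))).congr (ae_of_all _ fun x => ?_)
    simp only [integral_mul_const, rieszConv, riesz_kernel_eq, integral_const_mul]
    ring
  constructor
  · rw [locallyIntegrable_iff]
    intro k hk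
    refine (h'.integrableOn.continuousOn_mul (g := fun x => 1 + ‖x‖ ^ 4) (by fun_prop)
      hk).congr_fun (fun x _ => ?_) hk.measurableSet
    have : 1 + ‖x‖ ^ 4 ≠ 0 := by positivity
    field_simp
  · refine h'.abs.congr (ae_of_all _ fun x => ?_)
    simp only [abs_div, abs_of_pos (by positivity : (0:ℝ) < 1 + ‖x‖ ^ 4)]

/-- Half the symmetric second difference of `φ`, weighted by the kernel `|z|⁻⁴`. -/
noncomputable def secondDiff (φ : E3 → ℝ) (x z : E3) : ℝ :=
  (φ x - (φ (x + z) + φ (x - z)) / 2) / ‖z‖ ^ 4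

lemma exists_norm_fderiv_fderiv_le (φ : SchwartzMap E3 ℝ) :
    ∃ C, 0 ≤ C ∧ ∀ x, ‖fderiv ℝ (fderiv ℝ φ) x‖ ≤ C * (1 + ‖x‖) ^ (-4 : ℝ) := by
  let ψ := SchwartzMap.fderivCLM ℝ E3 ℝ φ
  obtain ⟨C, hC⟩ : ∃ C, ∀ x, (1 + ‖x‖) ^ 4 * ‖iteratedFDeriv ℝ 1 ψ x‖ ≤ C :=
    ⟨_, fun x => SchwartzMap.one_add_le_sup_seminorm_apply (𝕜 := ℝ) (m := (4, 1)) (k := 4) (n := 1)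
      le_rfl le_rfl ψ x⟩
  refine ⟨C, le_trans (by positivity) (hC 0), fun x => ?_⟩
  have h := hC x
  rw [norm_iteratedFDeriv_one] at h
  rw [rpow_neg (by positivity), show (4:ℝ) = ((4:ℕ):ℝ) by norm_num, rpow_natCast,
    ← div_eq_mul_inv, le_div_iff₀' (by positivity)]
  exact h

lemma exists_abs_second_difference_le (φ : SchwartzMap E3 ℝ) :
    ∃ C, 0 ≤ C ∧ ∀ x z, ‖z‖ ≤ 1 →
      |φ x - (φ (x + z) + φ (x - z)) / 2| ≤ C * (1 + ‖x‖) ^ (-4 : ℝ) * ‖z‖ ^ 2 := by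
  obtain ⟨C, hC, h⟩ := exists_norm_fderiv_fderiv_le φ
  refine ⟨16 * C, by positivity, fun x z hz => ?_⟩
  set B := 16 * C * (1 + ‖x‖) ^ (-4 : ℝ) with hB
  have hB0 : 0 ≤ B := by positivity
  have hd : Differentiable ℝ φ := φ.differentiable
  have hd2 : Differentiable ℝ (fderiv ℝ φ) := (SchwartzMap.fderivCLM ℝ E3 ℝ φ).differentiable
  have hb : ∀ u ∈ Metric.closedBall x 1, ‖fderiv ℝ (fderiv ℝ φ) u‖ ≤ B := by
    intro u hu
    refine (h u).trans ?_
    have h1 : 1 + ‖x‖ ≤ 2 * (1 + ‖u‖) := by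
      have := norm_le_norm_add_norm_sub' x u
      rw [Metric.mem_closedBall, dist_eq_norm, norm_sub_rev] at hu
      linarith [norm_nonneg u]
    have h2 : (1 + ‖u‖) ^ (-4 : ℝ) ≤ 16 * (1 + ‖x‖) ^ (-4 : ℝ) := by
      rw [rpow_neg (by positivity), rpow_neg (by positivity),
        show (4:ℝ) = ((4:ℕ):ℝ) by norm_num, rpow_natCast, rpow_natCast, ← div_eq_mul_inv,
        ← one_div, div_le_div_iff₀ (by positivity) (by positivity)]
      calc 1 * (1 + ‖x‖) ^ 4 ≤ 1 * (2 * (1 + ‖u‖)) ^ 4 := by gcongr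
        _ = _ := by ring
    calc C * (1 + ‖u‖) ^ (-4 : ℝ) ≤ C * (16 * (1 + ‖x‖) ^ (-4 : ℝ)) := by gcongr
      _ = B := by rw [hB]; ring
  have hG : ∀ w, HasFDerivAt (fun w => φ (x + w) + φ (x - w))
      (fderiv ℝ φ (x + w) - fderiv ℝ φ (x - w)) w := by
    intro w
    have h1 := (hd (x + w)).hasFDerivAt.comp w ((hasFDerivAt_id w).const_add x)
    have h2 := (hd (x - w)).hasFDerivAt.comp w ((hasFDerivAt_id w).const_sub x)
    refine (h1.add h2).congr_fderiv ?_
    ext v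
    simp [sub_eq_add_neg]
  have hL : ∀ w ∈ Metric.closedBall (0:E3) ‖z‖,
      ‖fderiv ℝ (fun w => φ (x + w) + φ (x - w)) w‖ ≤ 2 * B * ‖z‖ := by
    intro w hw
    rw [mem_closedBall_zero_iff] at hw
    rw [(hG w).fderiv]
    have := (convex_closedBall x (1:ℝ)).norm_image_sub_le_of_norm_fderiv_le (𝕜 := ℝ)
      (f := fderiv ℝ φ) (fun u _ => hd2 u) hb (x := x - w) (y := x + w)
      (by simp; linarith) (by simp; linarith)
    refine this.trans ?_
    have e : x + w - (x - w) = (2:ℝ) • w := by rw [two_smul]; abel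
    rw [e, norm_smul]
    simp only [Real.norm_ofNat]
    nlinarith [norm_nonneg w]
  have := (convex_closedBall (0:E3) ‖z‖).norm_image_sub_le_of_norm_fderiv_le (𝕜 := ℝ)
    (fun w _ => (hG w).differentiableAt) hL (x := 0) (y := z) (by simp) (by simp)
  simp only [add_zero, sub_zero, norm_eq_abs] at this
  rw [show φ x - (φ (x + z) + φ (x - z)) / 2 = -((φ (x + z) + φ (x - z) - (φ x + φ x)) / 2) by
    ring, abs_neg, abs_div, abs_two, div_le_iff₀ two_pos]
  linarith

lemma integrable_secondDiff (φ : SchwartzMap E3 ℝ) :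
    Integrable (fun p : E3 × E3 => secondDiff φ p.1 p.2) (volume.prod volume) := by
  obtain ⟨C, hC, h⟩ := exists_abs_second_difference_le φ
  have hφ : Integrable (fun x => |φ x|) := φ.integrable.abs
  have hw := ((integrable_one_add_norm (E := E3) (μ := volume) (r := 4)
    (by simp [finrank_euclideanSpace]; norm_num)).const_mul C)
  have hk := integrable_indicator_inv_norm_pow_four (ε := 1 / 2) (by norm_num)
  have i1 := hw.mul_prod integrable_indicator_ball_inv_norm_sq
  have i2 := hφ.mul_prod hk
  have i3 := Integrable.convolution_integrand (ContinuousLinearMap.mul ℝ ℝ) hk hφ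
  have i4 := ((MeasurePreserving.id (volume : Measure E3)).prod
    (Measure.measurePreserving_neg (volume : Measure E3))).integrable_comp_of_integrable i3
  refine (((i1.add i2).add i3).add i4).mono' ?_ (ae_of_all _ fun p => ?_)
  · refine Measurable.aestronglyMeasurable ?_
    have := φ.continuous.measurable
    unfold secondDiff
    fun_prop
  · obtain ⟨x, z⟩ := p
    simp only [Pi.add_apply, Function.comp_apply, secondDiff, ContinuousLinearMap.mul_apply',
      Prod.map, norm_neg, sub_neg_eq_add, id]
    rw [norm_div, norm_eq_abs, norm_eq_abs, abs_of_nonneg (by positivity : 0 ≤ ‖z‖ ^ 4)]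
    by_cases hz : ‖z‖ < 1
    · have h0 : 0 ≤ (Set.Ioi (1 / 2:ℝ)).indicator (fun r => 1 / r ^ 4) ‖z‖ :=
        Set.indicator_nonneg (fun _ _ => by positivity) _
      have h1 := h x z hz.le
      rw [Set.indicator_of_mem (s := Set.Iio (1:ℝ)) (by exact hz)]
      have h2 : |φ x - (φ (x + z) + φ (x - z)) / 2| / ‖z‖ ^ 4 ≤
          C * (1 + ‖x‖) ^ (-4 : ℝ) * (1 / ‖z‖ ^ 2) := by
        rcases (norm_nonneg z).eq_or_lt with h3 | h3
        · simp [← h3]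
        · rw [div_le_iff₀ (by positivity)]
          refine h1.trans (le_of_eq ?_)
          field_simp
      have := mul_nonneg (abs_nonneg (φ x)) h0
      have := mul_nonneg h0 (abs_nonneg (φ (x - z)))
      have := mul_nonneg h0 (abs_nonneg (φ (x + z)))
      linarith
    · have hz' : (1/2:ℝ) < ‖z‖ := by linarith
      rw [Set.indicator_of_mem (s := Set.Ioi (1/2:ℝ)) (by exact hz'),
        Set.indicator_of_notMem (s := Set.Iio (1:ℝ)) (by exact hz)]
      have : |φ x - (φ (x + z) + φ (x - z)) / 2| ≤ |φ x| + |φ (x - z)| + |φ (x + z)| := by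
        have := abs_sub (φ x) ((φ (x + z) + φ (x - z)) / 2)
        have h4 := abs_add_le (φ (x + z)) (φ (x - z))
        rw [abs_div, abs_two] at this
        linarith [abs_nonneg (φ (x + z) + φ (x - z))]
      calc _ ≤ (|φ x| + |φ (x - z)| + |φ (x + z)|) / ‖z‖ ^ 4 := by gcongr
        _ = _ := by ring

lemma integrableOn_difference_quotient (φ : SchwartzMap E3 ℝ) (x : E3) {ε : ℝ} (hε : 0 < ε) :
    IntegrableOn (fun z => (φ x - φ (x - z)) / ‖z‖ ^ 4) {z : E3 | ε < ‖z‖} := by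
  have hs : MeasurableSet {z : E3 | ε < ‖z‖} := measurableSet_lt (by fun_prop) (by fun_prop)
  obtain ⟨M, hM⟩ : ∃ M, ∀ y, ‖φ y‖ ≤ M := by
    obtain ⟨M, hM⟩ := φ.decay 0 0
    exact ⟨M, fun y => by simpa using hM.2 y⟩
  have h := (integrable_indicator_inv_norm_pow_four hε).integrableOn (s := {z : E3 | ε < ‖z‖})
  have h' : IntegrableOn (fun z : E3 => 1 / ‖z‖ ^ 4) {z : E3 | ε < ‖z‖} :=
    h.congr_fun (fun z hz => by dsimp only; rw [Set.indicator_of_mem (by exact hz)]) hs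
  refine (Integrable.bdd_mul (c := 2 * M) (f := fun z => φ x - φ (x - z)) h' ?_
    (ae_of_all _ fun z => ?_)).congr (ae_of_all _ fun z => ?_)
  · have := φ.continuous
    exact Continuous.aestronglyMeasurable (by fun_prop)
  · exact (norm_sub_le _ _).trans (by linarith [hM x, hM (x - z)])
  · simp only [mul_one_div]

lemma setIntegral_difference_quotient (φ : SchwartzMap E3 ℝ) (x : E3) {ε : ℝ} (hε : 0 < ε) :
    ∫ y in {y : E3 | ε < ‖x - y‖}, (φ x - φ y) / ‖x - y‖ ^ 4 =
      ∫ z in {z : E3 | ε < ‖z‖}, secondDiff φ x z := by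
  have hs : MeasurableSet {z : E3 | ε < ‖z‖} := measurableSet_lt (by fun_prop) (by fun_prop)
  have hs' : MeasurableSet {y : E3 | ε < ‖x - y‖} := measurableSet_lt (by fun_prop) (by fun_prop)
  have e1 : ∫ y in {y : E3 | ε < ‖x - y‖}, (φ x - φ y) / ‖x - y‖ ^ 4 =
      ∫ z in {z : E3 | ε < ‖z‖}, (φ x - φ (x - z)) / ‖z‖ ^ 4 := by
    rw [← integral_indicator hs, ← integral_indicator hs', ← integral_sub_left_eq_self _ volume x]
    congr 1 with z
    simp [Set.indicator]
  have e2 : ∫ z in {z : E3 | ε < ‖z‖}, (φ x - φ (x - z)) / ‖z‖ ^ 4 =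
      ∫ z in {z : E3 | ε < ‖z‖}, (φ x - φ (x + z)) / ‖z‖ ^ 4 := by
    rw [← integral_indicator hs, ← integral_indicator hs, ← integral_neg_eq_self]
    congr 1 with z
    simp [Set.indicator]
  have i1 := integrableOn_difference_quotient φ x hε
  have i2 : IntegrableOn (fun z => (φ x - φ (x + z)) / ‖z‖ ^ 4) {z : E3 | ε < ‖z‖} := by
    have := (i1.integrable_indicator hs).comp_neg
    refine (this.integrableOn (s := {z : E3 | ε < ‖z‖})).congr_fun (fun z hz => ?_) hs
    have : ε < ‖z‖ := hz
    simp [Set.indicator, this]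
  have e3 : ∫ z in {z : E3 | ε < ‖z‖}, secondDiff φ x z =
      (1 / 2) * ((∫ z in {z : E3 | ε < ‖z‖}, (φ x - φ (x - z)) / ‖z‖ ^ 4) +
        ∫ z in {z : E3 | ε < ‖z‖}, (φ x - φ (x + z)) / ‖z‖ ^ 4) := by
    rw [← integral_add i1 i2, ← integral_const_mul]
    congr 1 with z
    simp only [secondDiff]
    ring
  rw [e1, e3, ← e2]
  ring

lemma halfLap_eq_integral_secondDiff (φ : SchwartzMap E3 ℝ) {x : E3}
    (hx : Integrable (secondDiff φ x)) :
    halfLap φ x = 1 / π ^ 2 * ∫ z, secondDiff φ x z := by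
  refine Tendsto.limUnder_eq ?_
  have key : Tendsto (fun ε : ℝ => ∫ z, {z : E3 | ε < ‖z‖}.indicator (secondDiff φ x) z)
      (nhdsWithin (0:ℝ) (Set.Ioi 0)) (nhds (∫ z, secondDiff φ x z)) := by
    refine tendsto_integral_filter_of_dominated_convergence (fun z => ‖secondDiff φ x z‖)
      (Eventually.of_forall fun ε => ?_) (Eventually.of_forall fun ε => ae_of_all _ fun z => ?_)
      hx.norm (ae_of_all _ fun z => ?_)
    · exact hx.1.indicator (measurableSet_lt (by fun_prop) (by fun_prop))
    · exact norm_indicator_le_norm_self _ _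
    · refine tendsto_const_nhds.congr' ?_
      rcases eq_or_ne z 0 with rfl | hz
      · exact Eventually.of_forall fun ε => by simp [Set.indicator, secondDiff]
      · have : ∀ᶠ ε : ℝ in nhdsWithin 0 (Set.Ioi 0), ε < ‖z‖ :=
          nhdsWithin_le_nhds (Iio_mem_nhds (norm_pos_iff.2 hz))
        filter_upwards [this] with ε hε
        simp [Set.indicator, hε]
  refine (key.const_mul (1 / π ^ 2)).congr' ?_
  filter_upwards [self_mem_nhdsWithin] with ε hε
  rw [integral_indicator (measurableSet_lt (by fun_prop) (by fun_prop)),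
    setIntegral_difference_quotient φ x hε]

lemma halfLap_ae_eq (φ : SchwartzMap E3 ℝ) :
    ∀ᵐ x, halfLap φ x = 1 / π ^ 2 * ∫ z, secondDiff φ x z := by
  filter_upwards [(integrable_secondDiff φ).prod_right_ae] with x hx
  exact halfLap_eq_integral_secondDiff φ hx

lemma integrable_halfLap (φ : SchwartzMap E3 ℝ) : Integrable (halfLap φ) := by
  refine ((integrable_secondDiff φ).integral_prod_left.const_mul (1 / π ^ 2)).congr ?_
  filter_upwards [halfLap_ae_eq φ] with x hx
  exact hx.symm

lemma integrableOn_and_integral_rpow_mul_exp_neg_div {b : ℝ} (hb : 0 < b) :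
    IntegrableOn (fun s : ℝ => s ^ (-(3 / 2) : ℝ) * exp (-(b / s))) (Set.Ioi 0) ∧
      ∫ s in Set.Ioi (0:ℝ), s ^ (-(3 / 2) : ℝ) * exp (-(b / s)) = √π * b ^ (-(1 / 2) : ℝ) := by
  have e : Set.EqOn (fun s : ℝ => (|(-1:ℝ)| * s ^ ((-1:ℝ) - 1)) •
      ((fun u : ℝ => u ^ ((1 / 2 : ℝ) - 1) * exp (-(b * u))) (s ^ (-1:ℝ))))
      (fun s : ℝ => s ^ (-(3 / 2) : ℝ) * exp (-(b / s))) (Set.Ioi 0) := by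
    intro s hs
    have hs' : 0 < s := hs
    simp only [abs_neg, abs_one, one_mul, smul_eq_mul]
    rw [← rpow_mul hs'.le, ← mul_assoc, ← rpow_add hs', rpow_neg_one]
    norm_num
    exact Or.inl (div_eq_mul_inv b s).symm
  have h := integral_comp_rpow_Ioi (fun u : ℝ => u ^ ((1 / 2 : ℝ) - 1) * exp (-(b * u)))
    (p := -1) (by norm_num)
  have hv := integral_rpow_mul_exp_neg_mul_Ioi (a := 1 / 2) (by norm_num) hb
  have h' : ∫ s in Set.Ioi (0:ℝ), s ^ (-(3 / 2) : ℝ) * exp (-(b / s)) =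
      √π * b ^ (-(1 / 2) : ℝ) := by
    rw [← setIntegral_congr_fun measurableSet_Ioi e, h, hv, Gamma_one_half_eq, one_div b,
      inv_rpow hb.le, rpow_neg hb.le]
    ring
  refine ⟨?_, h'⟩
  by_contra hc
  rw [integral_undef hc] at h'
  have : 0 < √π * b ^ (-(1 / 2) : ℝ) := by positivity
  exact this.ne h'

lemma lintegral_rpow_mul_one_sub_exp_neg_div {a : ℝ} (ha : 0 ≤ a) :
    ∫⁻ t in Set.Ioi (0:ℝ), ENNReal.ofReal (t ^ (-(1 / 2) : ℝ) * (1 - exp (-(a / t)))) =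
      ENNReal.ofReal (2 * √π * √a) := by
  have e1 : ∀ t ∈ Set.Ioi (0:ℝ), ENNReal.ofReal (t ^ (-(1 / 2) : ℝ) * (1 - exp (-(a / t)))) =
      ∫⁻ b in Set.Ioc 0 a, ENNReal.ofReal (t ^ (-(3 / 2) : ℝ) * exp (-(b / t))) := by
    intro t ht
    have ht' : 0 < t := ht
    have hc : Continuous fun b : ℝ => t ^ (-(3 / 2) : ℝ) * exp (-(b / t)) := by fun_prop
    rw [← ofReal_integral_eq_lintegral_ofReal (hc.integrableOn_Ioc)
      (ae_of_all _ fun b => by positivity), ← intervalIntegral.integral_of_le ha,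
      intervalIntegral.integral_eq_sub_of_hasDerivAt
        (f := fun b => -(t ^ (-(1 / 2) : ℝ) * exp (-(b / t)))) (fun b _ => ?_)
        (hc.intervalIntegrable _ _)]
    · congr 1
      simp
      ring
    · have h1 : HasDerivAt (fun b : ℝ => exp (-(b / t))) (exp (-(b / t)) * (-(1 / t))) b :=
        (((hasDerivAt_id b).div_const t).neg).exp
      refine ((h1.const_mul (t ^ (-(1 / 2) : ℝ))).neg).congr_deriv ?_
      rw [show (-(3 / 2) : ℝ) = -(1 / 2) - 1 by norm_num, rpow_sub_one ht'.ne']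
      ring
  rw [setLIntegral_congr_fun measurableSet_Ioi e1, lintegral_lintegral_swap]
  · have e2 : ∀ b ∈ Set.Ioc 0 a, ∫⁻ t in Set.Ioi (0:ℝ),
        ENNReal.ofReal (t ^ (-(3 / 2) : ℝ) * exp (-(b / t))) =
        ENNReal.ofReal (√π * b ^ (-(1 / 2) : ℝ)) := by
      intro b hb
      obtain ⟨h1, h2⟩ := integrableOn_and_integral_rpow_mul_exp_neg_div hb.1
      rw [← h2, ofReal_integral_eq_lintegral_ofReal h1]
      filter_upwards [ae_restrict_mem measurableSet_Ioi] with t ht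
      have : 0 < t := ht
      positivity
    have hi : IntervalIntegrable (fun b : ℝ => b ^ (-(1 / 2) : ℝ)) volume 0 a :=
      intervalIntegral.intervalIntegrable_rpow' (by norm_num)
    rw [setLIntegral_congr_fun measurableSet_Ioc e2, ← ofReal_integral_eq_lintegral_ofReal]
    · rw [integral_const_mul, ← intervalIntegral.integral_of_le ha,
        integral_rpow (Or.inl (by norm_num))]
      rw [show (-(1 / 2) : ℝ) + 1 = 1 / 2 by norm_num, ← sqrt_eq_rpow, zero_rpow (by norm_num)]
      congr 1
      ring
    · exact ((intervalIntegrable_iff_integrableOn_Ioc_of_le ha).1 hi).const_mul _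
    · filter_upwards [ae_restrict_mem measurableSet_Ioc] with b hb
      have : 0 < b := hb.1
      positivity
  · refine Measurable.aemeasurable ?_
    unfold Function.uncurry
    fun_prop

lemma integrable_exp_neg_mul_norm_sq {s : ℝ} (hs : 0 < s) :
    Integrable (fun x : E3 => exp (-(s * ‖x‖ ^ 2))) := by
  have h := (GaussianFourier.integrable_cexp_neg_mul_sq_norm_add (V := E3) (b := (s:ℂ))
    (by simpa using hs) 0 0).re
  refine h.congr (ae_of_all _ fun x => ?_)
  have : (-(s:ℂ) * (‖x‖:ℂ) ^ 2 + 0 * (inner ℝ (0:E3) x : ℝ)) = ((-(s * ‖x‖ ^ 2) : ℝ) : ℂ) := by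
    push_cast; ring
  simp only [this]
  exact Complex.exp_ofReal_re _

lemma integral_fourierChar_mul_gaussian {s : ℝ} (hs : 0 < s) (ξ : E3) :
    ∫ x : E3, Complex.exp ((2 * π * inner ℝ x ξ : ℝ) * Complex.I) *
      (exp (-(s * ‖x‖ ^ 2)) : ℝ) =
      ((π / s) ^ (3 / 2 : ℝ) * exp (-(π ^ 2 * ‖ξ‖ ^ 2 / s)) : ℝ) := by
  have h := fourier_gaussian_innerProductSpace (V := E3) (b := (s:ℂ)) (by simpa using hs) (-ξ)
  rw [Real.fourier_eq'] at h
  convert h using 1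
  · congr 1 with x
    rw [smul_eq_mul, inner_neg_right]
    push_cast
    congr 2 <;> ring_nf
  · push_cast
    rw [Complex.ofReal_cpow (by positivity)]
    simp [finrank_euclideanSpace]
    left
    congr 1; ring

lemma integral_one_sub_cos_mul_gaussian {s : ℝ} (hs : 0 < s) (ξ : E3) :
    Integrable (fun x : E3 => (1 - cos (2 * π * inner ℝ x ξ)) * exp (-(s * ‖x‖ ^ 2))) ∧
    ∫ x : E3, (1 - cos (2 * π * inner ℝ x ξ)) * exp (-(s * ‖x‖ ^ 2)) =
      (π / s) ^ (3 / 2 : ℝ) * (1 - exp (-(π ^ 2 * ‖ξ‖ ^ 2 / s))) := by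
  have hg := integrable_exp_neg_mul_norm_sq hs
  have hi : ∀ ξ : E3, Integrable (fun x : E3 =>
      Complex.exp ((2 * π * inner ℝ x ξ : ℝ) * Complex.I) * (exp (-(s * ‖x‖ ^ 2)) : ℝ)) := by
    intro ξ
    refine (hg.ofReal (𝕜 := ℂ)).bdd_mul (c := 1) ?_ (ae_of_all _ fun x => ?_)
    · exact Continuous.aestronglyMeasurable (by fun_prop)
    · rw [Complex.norm_exp_ofReal_mul_I]
  have hre : ∀ ξ x : E3, (Complex.exp ((2 * π * inner ℝ x ξ : ℝ) * Complex.I) *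
      (exp (-(s * ‖x‖ ^ 2)) : ℝ)).re = cos (2 * π * inner ℝ x ξ) * exp (-(s * ‖x‖ ^ 2)) := by
    intro ξ x
    rw [Complex.re_mul_ofReal, Complex.exp_ofReal_mul_I_re]
  have hc : ∀ ξ : E3, ∫ x : E3, cos (2 * π * inner ℝ x ξ) * exp (-(s * ‖x‖ ^ 2)) =
      (π / s) ^ (3 / 2 : ℝ) * exp (-(π ^ 2 * ‖ξ‖ ^ 2 / s)) := by
    intro ξ
    have := congrArg Complex.re (integral_fourierChar_mul_gaussian hs ξ)
    rw [Complex.ofReal_re] at this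
    rw [← this, ← RCLike.re_eq_complex_re, ← integral_re (hi ξ)]
    congr 1 with x
    exact (hre ξ x).symm
  have hci : Integrable (fun x : E3 => cos (2 * π * inner ℝ x ξ) * exp (-(s * ‖x‖ ^ 2))) :=
    (hi ξ).re.congr (ae_of_all _ (hre ξ))
  have hg0 : ∫ x : E3, exp (-(s * ‖x‖ ^ 2)) = (π / s) ^ (3 / 2 : ℝ) := by
    simpa using hc 0
  simp only [sub_mul, one_mul]
  refine ⟨hg.sub hci, ?_⟩
  rw [integral_sub hg hci, hc, hg0]
  ring

lemma integrableOn_and_integral_mul_exp_neg {r : ℝ} (hr : 0 < r) :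
    IntegrableOn (fun t : ℝ => t * exp (-(t * r))) (Set.Ioi 0) ∧
      ∫ t in Set.Ioi (0:ℝ), t * exp (-(t * r)) = 1 / r ^ 2 := by
  have hv := integral_rpow_mul_exp_neg_mul_Ioi (a := 2) (by norm_num) hr
  have h : ∫ t in Set.Ioi (0:ℝ), t * exp (-(t * r)) = 1 / r ^ 2 := by
    have e : (2:ℝ) - 1 = 1 := by norm_num
    simp only [e, rpow_one, Gamma_two, mul_one, rpow_ofNat, one_div, inv_pow] at hv
    simpa only [one_div, mul_comm r] using hv
  refine ⟨?_, h⟩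
  by_contra hc
  rw [integral_undef hc] at h
  have : 0 < 1 / r ^ 2 := by positivity
  exact this.ne h

lemma integrableOn_and_integral_exp_neg_mul {r : ℝ} (hr : 0 < r) :
    IntegrableOn (fun t : ℝ => exp (-(t * r))) (Set.Ioi 0) ∧
      ∫ t in Set.Ioi (0:ℝ), exp (-(t * r)) = 1 / r := by
  have hv := integral_rpow_mul_exp_neg_mul_Ioi (a := 1) (by norm_num) hr
  have h : ∫ t in Set.Ioi (0:ℝ), exp (-(t * r)) = 1 / r := by
    simpa [mul_comm r] using hv
  refine ⟨?_, h⟩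
  by_contra hc
  rw [integral_undef hc] at h
  have : 0 < 1 / r := by positivity
  exact this.ne h

lemma lintegral_one_sub_cos_div_norm_pow_four (ξ : E3) :
    ∫⁻ z : E3, ENNReal.ofReal ((1 - cos (2 * π * inner ℝ z ξ)) / ‖z‖ ^ 4) =
      ENNReal.ofReal (2 * π ^ 3 * ‖ξ‖) := by
  have hq : ∀ θ : ℝ, 0 ≤ 1 - cos θ := fun θ => sub_nonneg.2 (cos_le_one θ)
  have e1 : ∀ z : E3, ENNReal.ofReal ((1 - cos (2 * π * inner ℝ z ξ)) / ‖z‖ ^ 4) =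
      ∫⁻ t in Set.Ioi (0:ℝ), ENNReal.ofReal
        ((1 - cos (2 * π * inner ℝ z ξ)) * (t * exp (-(t * ‖z‖ ^ 2)))) := by
    intro z
    rcases eq_or_ne z 0 with rfl | hz
    · simp
    · obtain ⟨h1, h2⟩ := integrableOn_and_integral_mul_exp_neg (r := ‖z‖ ^ 2) (by positivity)
      rw [← ofReal_integral_eq_lintegral_ofReal (h1.const_mul _), integral_const_mul, h2]
      · congr 1
        rw [← pow_mul, mul_one_div]
      · filter_upwards [ae_restrict_mem measurableSet_Ioi] with t ht
        have : 0 < t := ht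
        exact mul_nonneg (hq _) (by positivity)
  simp_rw [e1]
  rw [lintegral_lintegral_swap]
  · have e2 : ∀ t ∈ Set.Ioi (0:ℝ), ∫⁻ z : E3, ENNReal.ofReal
        ((1 - cos (2 * π * inner ℝ z ξ)) * (t * exp (-(t * ‖z‖ ^ 2)))) =
        ENNReal.ofReal (π ^ (3 / 2 : ℝ)) *
          ENNReal.ofReal (t ^ (-(1 / 2) : ℝ) * (1 - exp (-(π ^ 2 * ‖ξ‖ ^ 2 / t)))) := by
      intro t ht
      have ht' : 0 < t := ht
      obtain ⟨h1, h2⟩ := integral_one_sub_cos_mul_gaussian ht' ξ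
      have h3 : ∀ z : E3, (1 - cos (2 * π * inner ℝ z ξ)) * (t * exp (-(t * ‖z‖ ^ 2))) =
          t * ((1 - cos (2 * π * inner ℝ z ξ)) * exp (-(t * ‖z‖ ^ 2))) := fun z => by ring
      simp_rw [h3]
      rw [← ofReal_integral_eq_lintegral_ofReal (h1.const_mul t)
        (ae_of_all _ fun z => mul_nonneg ht'.le (mul_nonneg (hq _) (exp_pos _).le)),
        integral_const_mul, h2, ← ENNReal.ofReal_mul (by positivity)]
      congr 1
      rw [div_rpow pi_pos.le ht'.le, show (3 / 2 : ℝ) = 1 / 2 + 1 by norm_num, rpow_add_one ht'.ne',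
        rpow_neg ht'.le]
      field_simp
    rw [setLIntegral_congr_fun measurableSet_Ioi e2, lintegral_const_mul' _ _ ENNReal.ofReal_ne_top,
      lintegral_rpow_mul_one_sub_exp_neg_div (by positivity), ← ENNReal.ofReal_mul (by positivity)]
    congr 1
    rw [sqrt_mul (by positivity), sqrt_sq pi_pos.le, sqrt_sq (norm_nonneg _), sqrt_eq_rpow]
    calc π ^ (3 / 2 : ℝ) * (2 * π ^ (1 / 2 : ℝ) * (π * ‖ξ‖))
        = (π ^ (3 / 2 : ℝ) * π ^ (1 / 2 : ℝ)) * (2 * π * ‖ξ‖) := by ring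
      _ = _ := by
        rw [← rpow_add pi_pos, show (3 / 2 : ℝ) + 1 / 2 = (2 : ℕ) by norm_num, rpow_natCast]
        ring
  · refine Measurable.aemeasurable ?_
    unfold Function.uncurry
    fun_prop

lemma integral_one_sub_cos_div_norm_pow_four (ξ : E3) :
    Integrable (fun z : E3 => (1 - cos (2 * π * inner ℝ z ξ)) / ‖z‖ ^ 4) ∧
      ∫ z : E3, (1 - cos (2 * π * inner ℝ z ξ)) / ‖z‖ ^ 4 = 2 * π ^ 3 * ‖ξ‖ := by
  have h := lintegral_one_sub_cos_div_norm_pow_four ξ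
  have hm : AEStronglyMeasurable
      (fun z : E3 => (1 - cos (2 * π * inner ℝ z ξ)) / ‖z‖ ^ 4) volume :=
    Measurable.aestronglyMeasurable (by fun_prop)
  have h0 : 0 ≤ᵐ[volume] (fun z : E3 => (1 - cos (2 * π * inner ℝ z ξ)) / ‖z‖ ^ 4) :=
    ae_of_all _ fun z => div_nonneg (sub_nonneg.2 (cos_le_one _)) (by positivity)
  refine ⟨(lintegral_ofReal_ne_top_iff_integrable hm h0).1 (h ▸ ENNReal.ofReal_ne_top), ?_⟩
  rw [integral_eq_lintegral_of_nonneg_ae h0 hm, h, ENNReal.toReal_ofReal (by positivity)]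

/-- The character `ξ ↦ e^{2πi x·ξ}`. -/
noncomputable def planeWave (x ξ : E3) : ℂ := Complex.exp ((2 * π * inner ℝ x ξ : ℝ) * Complex.I)

lemma norm_planeWave (x ξ : E3) : ‖planeWave x ξ‖ = 1 := Complex.norm_exp_ofReal_mul_I _

@[fun_prop]
lemma continuous_planeWave : Continuous fun p : E3 × E3 => planeWave p.1 p.2 := by
  unfold planeWave
  fun_prop

lemma planeWave_add (x z ξ : E3) : planeWave (x + z) ξ = planeWave x ξ * planeWave z ξ := by
  simp only [planeWave, ← Complex.exp_add, inner_add_left]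
  push_cast
  ring_nf

lemma planeWave_add_planeWave_neg (z ξ : E3) :
    planeWave z ξ + planeWave (-z) ξ = 2 * (cos (2 * π * inner ℝ z ξ) : ℝ) := by
  simp only [planeWave, inner_neg_left, Complex.ofReal_cos, Complex.two_cos]
  push_cast
  ring_nf

/-- The Fourier transform of a real Schwartz function. -/
noncomputable def schwartzFourier (φ : SchwartzMap E3 ℝ) : SchwartzMap E3 ℂ :=
  FourierTransform.fourier (SchwartzMap.postcompCLM (𝕜 := ℝ) Complex.ofRealCLM φ)

lemma integrable_planeWave_mul {m : E3 → ℂ} (hm : Integrable m) (x : E3) :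
    Integrable (fun ξ => planeWave x ξ * m ξ) :=
  hm.bdd_mul (c := 1) (Continuous.aestronglyMeasurable (by fun_prop))
    (ae_of_all _ fun ξ => (norm_planeWave x ξ).le)

lemma eq_integral_planeWave_mul (φ : SchwartzMap E3 ℝ) (x : E3) :
    (φ x : ℂ) = ∫ ξ, planeWave x ξ * schwartzFourier φ ξ := by
  have h : FourierTransformInv.fourierInv (schwartzFourier φ) =
      SchwartzMap.postcompCLM (𝕜 := ℝ) Complex.ofRealCLM φ := by
    simp [schwartzFourier]
  have h2 := DFunLike.congr_fun h x
  rw [SchwartzMap.fourierInv_coe, Real.fourierInv_eq'] at h2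
  rw [SchwartzMap.postcompCLM_apply, Complex.ofRealCLM_apply] at h2
  rw [← h2]
  congr 1 with ξ
  rw [smul_eq_mul, planeWave, real_inner_comm]

lemma secondDiff_eq_integral (φ : SchwartzMap E3 ℝ) (x z : E3) :
    (secondDiff φ x z : ℂ) = ∫ ξ, ((1 - cos (2 * π * inner ℝ z ξ)) / ‖z‖ ^ 4 : ℝ) *
      (planeWave x ξ * schwartzFourier φ ξ) := by
  have hi := integrable_planeWave_mul (schwartzFourier φ).integrable
  unfold secondDiff
  push_cast
  rw [eq_integral_planeWave_mul φ x, eq_integral_planeWave_mul φ (x + z),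
    eq_integral_planeWave_mul φ (x - z), ← integral_add (hi _) (hi _), ← integral_div,
    ← integral_sub (hi _) (((hi (x + z)).add (hi (x - z))).div_const 2 :
      Integrable (fun ξ => (planeWave (x + z) ξ * schwartzFourier φ ξ +
        planeWave (x - z) ξ * schwartzFourier φ ξ) / 2)), ← integral_div]
  congr 1 with ξ
  have h := planeWave_add_planeWave_neg z ξ
  rw [sub_eq_add_neg x z, planeWave_add, planeWave_add]
  push_cast at h ⊢
  linear_combination (-(1 / 2) * planeWave x ξ * schwartzFourier φ ξ / (‖z‖:ℂ) ^ 4) * h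

/-- The Fourier transform of `(-Δ)^{1/2} φ`. -/
noncomputable def halfLapFourier (φ : SchwartzMap E3 ℝ) (ξ : E3) : ℂ :=
  (2 * π * ‖ξ‖ : ℝ) * schwartzFourier φ ξ

lemma integrable_halfLapFourier (φ : SchwartzMap E3 ℝ) : Integrable (halfLapFourier φ) := by
  have h := ((schwartzFourier φ).integrable_pow_mul volume 1).const_mul (2 * π)
  refine h.mono' ?_ (ae_of_all _ fun ξ => ?_)
  · have := (schwartzFourier φ).continuous
    unfold halfLapFourier
    exact Continuous.aestronglyMeasurable (by fun_prop)
  · rw [halfLapFourier, norm_mul, Complex.norm_real, norm_of_nonneg (by positivity)]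
    simp only [pow_one]
    linarith

lemma integral_secondDiff (φ : SchwartzMap E3 ℝ) (x : E3) :
    ((∫ z, secondDiff φ x z : ℝ) : ℂ) = π ^ 2 * ∫ ξ, planeWave x ξ * halfLapFourier φ ξ := by
  have hc := (schwartzFourier φ).continuous
  have hprod : Integrable (fun p : E3 × E3 => ((1 - cos (2 * π * inner ℝ p.2 p.1)) / ‖p.2‖ ^ 4 : ℝ) *
      (planeWave x p.1 * schwartzFourier φ p.1)) (volume.prod volume) := by
    rw [integrable_prod_iff]
    · refine ⟨ae_of_all _ fun ξ => ?_, ?_⟩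
      · exact ((integral_one_sub_cos_div_norm_pow_four ξ).1.ofReal (𝕜 := ℂ)).mul_const
          (planeWave x ξ * schwartzFourier φ ξ)
      · refine ((integrable_halfLapFourier φ).norm.const_mul (π ^ 2)).congr
          (ae_of_all _ fun ξ => ?_)
        have h : ∀ z : E3, ‖(((1 - cos (2 * π * inner ℝ z ξ)) / ‖z‖ ^ 4 : ℝ) : ℂ) *
            (planeWave x ξ * schwartzFourier φ ξ)‖ =
            (1 - cos (2 * π * inner ℝ z ξ)) / ‖z‖ ^ 4 * ‖schwartzFourier φ ξ‖ := by
          intro z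
          rw [norm_mul, norm_mul, norm_planeWave, one_mul, Complex.norm_real,
            norm_of_nonneg (div_nonneg (sub_nonneg.2 (cos_le_one _)) (by positivity))]
        simp only [h]
        rw [integral_mul_const, (integral_one_sub_cos_div_norm_pow_four ξ).2, halfLapFourier,
          norm_mul, Complex.norm_real, norm_of_nonneg (by positivity)]
        ring
    · refine Measurable.aestronglyMeasurable ?_
      have := hc.measurable
      have : Measurable fun p : E3 × E3 => planeWave x p.1 :=
        Continuous.measurable (by fun_prop)
      fun_prop
  rw [← integral_complex_ofReal]
  simp_rw [secondDiff_eq_integral]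
  rw [← integral_integral_swap hprod, ← integral_const_mul]
  congr 1 with ξ
  rw [integral_mul_const, integral_complex_ofReal, (integral_one_sub_cos_div_norm_pow_four ξ).2,
    halfLapFourier]
  push_cast
  ring

lemma halfLap_ae_eq_integral (φ : SchwartzMap E3 ℝ) :
    ∀ᵐ x, (halfLap φ x : ℂ) = ∫ ξ, planeWave x ξ * halfLapFourier φ ξ := by
  filter_upwards [halfLap_ae_eq φ] with x hx
  have : (π : ℂ) ≠ 0 := by exact_mod_cast pi_ne_zero
  rw [hx, Complex.ofReal_mul, integral_secondDiff]
  push_cast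
  field_simp

lemma norm_halfLap_le (φ : SchwartzMap E3 ℝ) :
    ∀ᵐ x, ‖halfLap φ x‖ ≤ ∫ ξ, ‖halfLapFourier φ ξ‖ := by
  filter_upwards [halfLap_ae_eq_integral φ] with x hx
  rw [← Complex.norm_real, hx]
  refine (norm_integral_le_integral_norm _).trans (le_of_eq ?_)
  simp only [norm_mul, norm_planeWave, one_mul]

lemma integral_gaussian_mul_halfLap (φ : SchwartzMap E3 ℝ) (y : E3) {s : ℝ} (hs : 0 < s) :
    ∫ x, (exp (-(s * ‖x - y‖ ^ 2)) : ℂ) * (halfLap φ x : ℂ) =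
      ∫ ξ, ((π / s) ^ (3 / 2 : ℝ) * exp (-(π ^ 2 * ‖ξ‖ ^ 2 / s)) : ℝ) *
        (planeWave y ξ * halfLapFourier φ ξ) := by
  have hm := integrable_halfLapFourier φ
  have hg := (integrable_exp_neg_mul_norm_sq hs).comp_sub_right y
  have hprod : Integrable (fun p : E3 × E3 => planeWave p.1 p.2 *
      ((exp (-(s * ‖p.1 - y‖ ^ 2)) : ℝ) * halfLapFourier φ p.2)) (volume.prod volume) :=
    ((hg.ofReal (𝕜 := ℂ)).mul_prod hm).bdd_mul (c := 1)
      (Continuous.aestronglyMeasurable (by fun_prop))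
      (ae_of_all _ fun p => (norm_planeWave _ _).le)
  calc ∫ x, (exp (-(s * ‖x - y‖ ^ 2)) : ℂ) * (halfLap φ x : ℂ)
      = ∫ x, ∫ ξ, planeWave x ξ * ((exp (-(s * ‖x - y‖ ^ 2)) : ℝ) * halfLapFourier φ ξ) := by
        refine integral_congr_ae ?_
        filter_upwards [halfLap_ae_eq_integral φ] with x hx
        rw [hx, ← integral_const_mul]
        congr 1 with ξ
        push_cast
        ring
    _ = ∫ ξ, ∫ x, planeWave x ξ * ((exp (-(s * ‖x - y‖ ^ 2)) : ℝ) * halfLapFourier φ ξ) :=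
        integral_integral_swap hprod
    _ = _ := by
        congr 1 with ξ
        rw [← integral_fourierChar_mul_gaussian hs ξ, ← integral_mul_const,
          ← integral_add_right_eq_self _ y]
        congr 1 with x
        rw [planeWave_add, add_sub_cancel_right, planeWave]
        ring

lemma integral_Ioi_gaussianFourier (φ : SchwartzMap E3 ℝ) (y : E3) :
    ∫ s in Set.Ioi (0:ℝ), ∫ ξ, ((π / s) ^ (3 / 2 : ℝ) * exp (-(π ^ 2 * ‖ξ‖ ^ 2 / s)) : ℝ) *
        (planeWave y ξ * halfLapFourier φ ξ) = 2 * π ^ 2 * φ y := by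
  have hmc : Continuous (halfLapFourier φ) := by
    have := (schwartzFourier φ).continuous
    unfold halfLapFourier
    fun_prop
  have key : ∀ ξ : E3, ξ ≠ 0 →
      IntegrableOn (fun s : ℝ => (π / s) ^ (3 / 2 : ℝ) * exp (-(π ^ 2 * ‖ξ‖ ^ 2 / s)))
        (Set.Ioi 0) ∧
      ∫ s in Set.Ioi (0:ℝ), (π / s) ^ (3 / 2 : ℝ) * exp (-(π ^ 2 * ‖ξ‖ ^ 2 / s)) = π / ‖ξ‖ := by
    intro ξ hξ
    have hn : 0 < ‖ξ‖ := norm_pos_iff.2 hξ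
    obtain ⟨h1, h2⟩ := integrableOn_and_integral_rpow_mul_exp_neg_div
      (b := π ^ 2 * ‖ξ‖ ^ 2) (by positivity)
    have e : Set.EqOn (fun s : ℝ => π ^ (3 / 2 : ℝ) *
        (s ^ (-(3 / 2) : ℝ) * exp (-(π ^ 2 * ‖ξ‖ ^ 2 / s))))
        (fun s : ℝ => (π / s) ^ (3 / 2 : ℝ) * exp (-(π ^ 2 * ‖ξ‖ ^ 2 / s))) (Set.Ioi 0) := by
      intro s hs
      have hs' : 0 < s := hs
      simp only
      rw [div_rpow pi_pos.le hs'.le, rpow_neg hs'.le]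
      ring
    refine ⟨IntegrableOn.congr_fun (h1.const_mul _) e measurableSet_Ioi, ?_⟩
    rw [← setIntegral_congr_fun measurableSet_Ioi e, integral_const_mul, h2,
      rpow_neg (by positivity), ← sqrt_eq_rpow, ← mul_pow, sqrt_sq (by positivity), sqrt_eq_rpow,
      ← mul_assoc, ← rpow_add pi_pos, show (3 / 2 : ℝ) + 1 / 2 = (2 : ℕ) by norm_num, rpow_natCast]
    field_simp
  have hne : ∀ᵐ ξ : E3, ξ ≠ 0 := Measure.ae_ne volume 0
  have hprod : Integrable (fun p : E3 × ℝ =>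
      (((π / p.2) ^ (3 / 2 : ℝ) * exp (-(π ^ 2 * ‖p.1‖ ^ 2 / p.2)) : ℝ) : ℂ) *
        (planeWave y p.1 * halfLapFourier φ p.1))
      ((volume : Measure E3).prod (volume.restrict (Set.Ioi (0:ℝ)))) := by
    rw [integrable_prod_iff]
    · constructor
      · filter_upwards [hne] with ξ hξ
        exact ((key ξ hξ).1.ofReal (𝕜 := ℂ)).mul_const (planeWave y ξ * halfLapFourier φ ξ)
      · refine ((schwartzFourier φ).integrable.norm.const_mul (2 * π ^ 2)).congr ?_
        filter_upwards [hne] with ξ hξ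
        have hn : 0 < ‖ξ‖ := norm_pos_iff.2 hξ
        have h : ∀ s ∈ Set.Ioi (0:ℝ),
            ‖(((π / s) ^ (3 / 2 : ℝ) * exp (-(π ^ 2 * ‖ξ‖ ^ 2 / s)) : ℝ) : ℂ) *
              (planeWave y ξ * halfLapFourier φ ξ)‖ =
            (π / s) ^ (3 / 2 : ℝ) * exp (-(π ^ 2 * ‖ξ‖ ^ 2 / s)) * ‖halfLapFourier φ ξ‖ := by
          intro s hs
          have hs' : 0 < s := hs
          rw [norm_mul, norm_mul, norm_planeWave, one_mul, Complex.norm_real,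
            norm_of_nonneg (by positivity)]
        rw [setIntegral_congr_fun measurableSet_Ioi h, integral_mul_const, (key ξ hξ).2,
          halfLapFourier, norm_mul, Complex.norm_real, norm_of_nonneg (by positivity)]
        field_simp
    · refine Measurable.aestronglyMeasurable ?_
      have := hmc.measurable
      have : Measurable fun p : E3 × ℝ => planeWave y p.1 :=
        Continuous.measurable (by fun_prop)
      fun_prop
  rw [← integral_integral_swap hprod, eq_integral_planeWave_mul φ y, ← integral_const_mul]
  refine integral_congr_ae ?_
  filter_upwards [hne] with ξ hξ
  have hn : (‖ξ‖ : ℂ) ≠ 0 := by exact_mod_cast (norm_pos_iff.2 hξ).ne'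
  rw [integral_mul_const, integral_complex_ofReal, (key ξ hξ).2, halfLapFourier]
  push_cast
  field_simp

lemma integral_inv_norm_sub_sq_mul_halfLap (φ : SchwartzMap E3 ℝ) {y : E3}
    (hy : Integrable (fun x => 1 / ‖x - y‖ ^ 2 * halfLap φ x)) :
    ∫ x, 1 / ‖x - y‖ ^ 2 * halfLap φ x = 2 * π ^ 2 * φ y := by
  have hg := integrable_halfLap φ
  have hne : ∀ᵐ x : E3, x ≠ y := Measure.ae_ne volume y
  have key : ∀ x : E3, x ≠ y → IntegrableOn (fun s : ℝ => exp (-(s * ‖x - y‖ ^ 2))) (Set.Ioi 0) ∧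
      ∫ s in Set.Ioi (0:ℝ), exp (-(s * ‖x - y‖ ^ 2)) = 1 / ‖x - y‖ ^ 2 := fun x hx =>
    have : 0 < ‖x - y‖ := norm_pos_iff.2 (sub_ne_zero.2 hx)
    integrableOn_and_integral_exp_neg_mul (by positivity)
  have hprod : Integrable (fun p : E3 × ℝ => exp (-(p.2 * ‖p.1 - y‖ ^ 2)) * halfLap φ p.1)
      ((volume : Measure E3).prod (volume.restrict (Set.Ioi (0:ℝ)))) := by
    rw [integrable_prod_iff]
    · constructor
      · filter_upwards [hne] with x hx
        exact (key x hx).1.mul_const _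
      · refine hy.norm.congr ?_
        filter_upwards [hne] with x hx
        simp only [norm_mul, norm_of_nonneg (exp_pos _).le]
        rw [integral_mul_const, (key x hx).2, norm_of_nonneg (by positivity)]
    · refine AEStronglyMeasurable.mul (Continuous.aestronglyMeasurable (by fun_prop)) ?_
      exact hg.1.comp_fst
  have h1 : ∫ x, 1 / ‖x - y‖ ^ 2 * halfLap φ x =
      ∫ s in Set.Ioi (0:ℝ), ∫ x, exp (-(s * ‖x - y‖ ^ 2)) * halfLap φ x := by
    rw [← integral_integral_swap hprod]
    refine integral_congr_ae ?_
    filter_upwards [hne] with x hx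
    rw [integral_mul_const, (key x hx).2]
  have h2 : ((∫ s in Set.Ioi (0:ℝ), ∫ x, exp (-(s * ‖x - y‖ ^ 2)) * halfLap φ x : ℝ) : ℂ) =
      2 * π ^ 2 * φ y := by
    rw [← integral_Ioi_gaussianFourier φ y, ← integral_complex_ofReal]
    refine setIntegral_congr_fun measurableSet_Ioi fun s hs => ?_
    rw [← integral_gaussian_mul_halfLap φ y hs, ← integral_complex_ofReal]
    simp only [Complex.ofReal_mul]
  rw [h1]
  exact_mod_cast h2

lemma integral_rieszConv_mul_halfLap {f : E3 → ℝ} (hf : Integrable f) (φ : SchwartzMap E3 ℝ) :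
    ∫ x, rieszConv f x * halfLap φ x = ∫ x, f x * φ x := by
  have hg := integrable_halfLap φ
  have hprod := integrable_inv_norm_sub_sq_mul hf hg (norm_halfLap_le φ)
  have hae := (integrable_inv_norm_sub_sq_mul integrable_one_div_one_add_norm_pow_four hg
    (norm_halfLap_le φ)).prod_left_ae
  calc ∫ x, rieszConv f x * halfLap φ x
      = 1 / (2 * π ^ 2) * ∫ x, ∫ y, 1 / ‖x - y‖ ^ 2 * f y * halfLap φ x := by
        rw [← integral_const_mul]
        congr 1 with x
        simp only [rieszConv, riesz_kernel_eq, integral_const_mul, integral_mul_const]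
        ring
    _ = 1 / (2 * π ^ 2) * ∫ y, ∫ x, 1 / ‖x - y‖ ^ 2 * f y * halfLap φ x := by
        rw [integral_integral_swap hprod]
    _ = ∫ y, f y * φ y := by
        rw [← integral_const_mul]
        refine integral_congr_ae ?_
        filter_upwards [hae] with y hy
        have hy' : Integrable (fun x => 1 / ‖x - y‖ ^ 2 * halfLap φ x) := by
          refine (hy.const_mul (1 + ‖y‖ ^ 4)).congr (ae_of_all _ fun x => ?_)
          have : 1 + ‖y‖ ^ 4 ≠ 0 := by positivity
          field_simp
        have e : ∀ x, 1 / ‖x - y‖ ^ 2 * f y * halfLap φ x =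
            f y * (1 / ‖x - y‖ ^ 2 * halfLap φ x) := fun x => by ring
        simp_rw [e]
        rw [integral_const_mul, integral_inv_norm_sub_sq_mul_halfLap φ hy']
        field_simp

/-- Theorem 15: `K(x) = 1/(2π²|x|²)` is a fundamental solution of `(−Δ)^{1/2}` in ℝ³:
for every `f ∈ L¹(ℝ³)` the convolution `K∗f` is defined a.e., belongs to `L_{1/2}(ℝ³)`,
and `(−Δ)^{1/2}(K∗f) = f` in the sense of tempered distributions. -/
theorem fundamental_solution_half_laplacian (f : E3 → ℝ) (hf : Integrable f volume) :
    (∀ᵐ x : E3, Integrable (fun y : E3 => 1 / (2 * Real.pi ^ 2 * ‖x - y‖ ^ 2) * f y) volume) ∧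
    MemL12 (fun x : E3 => ∫ y, 1 / (2 * Real.pi ^ 2 * ‖x - y‖ ^ 2) * f y) ∧
    ∀ φ : SchwartzMap E3 ℝ,
      ∫ x, (∫ y, 1 / (2 * Real.pi ^ 2 * ‖x - y‖ ^ 2) * f y) * halfLap φ x =
        ∫ x, f x * φ x := by
  exact ⟨ae_integrable_riesz hf, memL12_rieszConv hf, integral_rieszConv_mul_halfLap hf⟩
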